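/- Assume K has characteristic 0 and let I ⊆ K[x_0, …, x_N] be the radical ideal of a finite set of distinct points in P^N. Then I^{(t(N+m−1)+s)} ⊆ M^s (I^{(m)})^t for all integers s, t, m ≥ 1. -/

import Mathlib

open MvPolynomial

noncomputable section

/-- The ideal generated by all homogeneous forms vanishing at the point with
coordinate vector `p`. -/
def homVanishingIdeal {K σ : Type*} [Field K] (p : σ → K) : Ideal (MvPolynomial σ K) :=
  Ideal.span {F : MvPolynomial σ K | (∃ d, F.IsHomogeneous d) ∧ MvPolynomial.eval p F = 0}

/-- The `m`-th symbolic power of the radical ideal of the finite set of points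
with coordinate vectors `P i`: the intersection of the `m`-th powers of the
ideals of the individual points. -/
def symbPow {K σ ι : Type*} [Field K] (P : ι → σ → K) (m : ℕ) : Ideal (MvPolynomial σ K) :=
  ⨅ i, homVanishingIdeal (P i) ^ m

/-- The irrelevant maximal ideal `M = (x_0, …, x_N)`. -/
def irrel (K σ : Type*) [Field K] : Ideal (MvPolynomial σ K) :=
  Ideal.span (Set.range (MvPolynomial.X : σ → MvPolynomial σ K))

/-- The coordinate vectors `P i` are nonzero and represent pairwise distinct
points of projective space (no two are proportional). -/
def ProjectivelyDistinct {K σ ι : Type*} [Field K] (P : ι → σ → K) : Prop :=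
  (∀ i, P i ≠ 0) ∧ Pairwise fun i j => ∀ c : K, P i ≠ c • P j

/-- `α(J)`: the least degree of a nonzero homogeneous element of `J`. -/
def idealAlpha {K σ : Type*} [Field K] (J : Ideal (MvPolynomial σ K)) : ℕ :=
  sInf {d : ℕ | ∃ F ∈ J, F ≠ 0 ∧ MvPolynomial.IsHomogeneous F d}

section FrobeniusComponents

variable {σ k : Type*} [Field k] (p e : ℕ) [Fact p.Prime] [CharP k p] [PerfectRing k p]

/-- The additive map sending `h` to the polynomial whose `v`-th coefficient is the `p ^ e`-th root
of the coefficient of `h` at `p ^ e • v + u`. -/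
def frobComponent (u : σ →₀ ℕ) : MvPolynomial σ k →+ MvPolynomial σ k :=
  have hinj : Function.Injective fun v : σ →₀ ℕ => p ^ e • v + u := fun v w h => by
    ext l
    have h1 := DFunLike.congr_fun h l
    have h0 : 0 < p ^ e := pow_pos (Fact.out : p.Prime).pos e
    simpa [h0.ne', (Fact.out : p.Prime).ne_zero] using h1
  have hcoeff : ∀ (h : MvPolynomial σ k) (v : σ →₀ ℕ),
      coeff v (∑ w ∈ h.support.preimage (fun v => p ^ e • v + u) hinj.injOn,
        monomial w ((iterateFrobeniusEquiv k p e).symm (coeff (p ^ e • w + u) h))) =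
      (iterateFrobeniusEquiv k p e).symm (coeff (p ^ e • v + u) h) := fun h v => by
    classical
    simp only [coeff_sum, coeff_monomial, Finset.sum_ite_eq', Finset.mem_preimage]
    split_ifs with hv
    · rfl
    · rw [notMem_support_iff] at hv
      simp [hv]
  { toFun := fun h => ∑ w ∈ h.support.preimage (fun v => p ^ e • v + u) hinj.injOn,
      monomial w ((iterateFrobeniusEquiv k p e).symm (coeff (p ^ e • w + u) h))
    map_zero' := by ext v; rw [hcoeff]; simp
    map_add' := fun f g => by
      ext v
      rw [coeff_add, hcoeff, hcoeff, hcoeff, coeff_add, map_add] }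

theorem coeff_frobComponent (u v : σ →₀ ℕ) (h : MvPolynomial σ k) :
    coeff v (frobComponent p e u h) =
      (iterateFrobeniusEquiv k p e).symm (coeff (p ^ e • v + u) h) := by
  classical
  simp only [frobComponent, AddMonoidHom.coe_mk, ZeroHom.coe_mk, coeff_sum, coeff_monomial,
    Finset.sum_ite_eq', Finset.mem_preimage]
  split_ifs with hv
  · rfl
  · rw [notMem_support_iff] at hv
    simp [hv]

theorem frobComponent_pow_mul {u : σ →₀ ℕ} (hu : ∀ l, u l < p ^ e) (r s : MvPolynomial σ k) :
    frobComponent p e u (r ^ p ^ e * s) = r * frobComponent p e u s := by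
  classical
  induction r using MvPolynomial.induction_on' with
  | add f g hf hg => rw [add_pow_char_pow, add_mul, map_add, hf, hg, add_mul]
  | monomial v a =>
    ext w
    rw [coeff_frobComponent, monomial_pow, coeff_monomial_mul', coeff_monomial_mul']
    have hq : 0 < p ^ e := pow_pos (Fact.out : p.Prime).pos e
    have hiff : p ^ e • v ≤ p ^ e • w + u ↔ v ≤ w := by
      refine ⟨fun h l => ?_, fun h l => ?_⟩
      · have h1 := h l
        have h2 := hu l
        simp only [Finsupp.smul_apply, Finsupp.add_apply, smul_eq_mul] at h1
        by_contra! hc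
        have h3 : p ^ e * (w l + 1) ≤ p ^ e * v l := Nat.mul_le_mul_left _ hc
        rw [mul_add] at h3
        omega
      · have h1 : p ^ e * v l ≤ p ^ e * w l := Nat.mul_le_mul_left _ (h l)
        simp only [Finsupp.smul_apply, Finsupp.add_apply, smul_eq_mul]
        omega
    by_cases hvw : v ≤ w
    · rw [if_pos hvw, if_pos (hiff.2 hvw), map_mul, coeff_frobComponent]
      congr 1
      · rw [← iterateFrobenius_def, ← iterateFrobeniusEquiv_apply, RingEquiv.symm_apply_apply]
      · congr 2
        ext l
        have h1 : p ^ e * v l ≤ p ^ e * w l := Nat.mul_le_mul_left _ (hvw l)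
        simp only [Finsupp.tsub_apply, Finsupp.smul_apply, Finsupp.add_apply, smul_eq_mul,
          Nat.mul_sub]
        omega
    · rw [if_neg hvw, if_neg (mt hiff.1 hvw), map_zero]

theorem frobComponent_mem {u : σ →₀ ℕ} (hu : ∀ l, u l < p ^ e) {J : Ideal (MvPolynomial σ k)}
    {h : MvPolynomial σ k} (hh : h ∈ J.map (iterateFrobenius (MvPolynomial σ k) p e)) :
    frobComponent p e u h ∈ J := by
  suffices ∀ a, frobComponent p e u (a * h) ∈ J by simpa using this 1
  induction hh using Submodule.span_induction with
  | mem x hx =>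
    obtain ⟨r, hr, rfl⟩ := hx
    intro a
    rw [iterateFrobenius_def, mul_comm, frobComponent_pow_mul p e hu]
    exact Ideal.mul_mem_right _ _ hr
  | zero => simp
  | add x y _ _ hx hy => exact fun a => by rw [mul_add, map_add]; exact add_mem (hx a) (hy a)
  | smul b x _ hx => exact fun a => by rw [smul_eq_mul, ← mul_assoc]; exact hx _

theorem sum_frobComponent_pow_mul [Fintype σ] [DecidableEq σ] (h : MvPolynomial σ k) :
    ∑ u : σ → Fin (p ^ e),
      frobComponent p e (Finsupp.equivFunOnFinite.symm fun l => (u l : ℕ)) h ^ p ^ e *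
        monomial (Finsupp.equivFunOnFinite.symm fun l => (u l : ℕ)) 1 = h := by
  have hq : 0 < p ^ e := pow_pos (Fact.out : p.Prime).pos e
  induction h using MvPolynomial.induction_on' with
  | add f g hf hg =>
    conv_rhs => rw [← hf, ← hg]
    rw [← Finset.sum_add_distrib]
    refine Finset.sum_congr rfl fun u _ => ?_
    rw [map_add, add_pow_char_pow, add_mul]
  | monomial w b =>
    rw [Finset.sum_eq_single fun l => ⟨w l % p ^ e, Nat.mod_lt _ hq⟩]
    · have h1 : frobComponent p e (Finsupp.equivFunOnFinite.symm fun l => w l % p ^ e)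
          (monomial w b) = monomial (Finsupp.equivFunOnFinite.symm fun l => w l / p ^ e)
            ((iterateFrobeniusEquiv k p e).symm b) := by
        ext v
        rw [coeff_frobComponent, coeff_monomial, coeff_monomial, apply_ite
          (iterateFrobeniusEquiv k p e).symm, map_zero]
        refine if_congr ?_ rfl rfl
        simp only [Finsupp.ext_iff, Finsupp.add_apply, Finsupp.smul_apply, smul_eq_mul,
          Finsupp.equivFunOnFinite_symm_apply_apply]
        refine forall_congr' fun l => ?_
        have h2 := Nat.div_add_mod (w l) (p ^ e)
        refine ⟨fun h3 => Nat.eq_of_mul_eq_mul_left hq (Nat.add_right_cancel (h2.trans h3)),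
          fun h3 => ?_⟩
        rw [← h3]
        exact h2.symm
      rw [h1, monomial_pow, monomial_mul, mul_one, ← iterateFrobenius_def,
        ← iterateFrobeniusEquiv_apply, RingEquiv.apply_symm_apply]
      refine congrArg (fun v => monomial v b) (Finsupp.ext fun l => ?_)
      simp [Nat.div_add_mod]
    · intro u _ hu
      convert zero_mul _
      rw [pow_eq_zero_iff hq.ne']
      ext v
      rw [coeff_frobComponent, coeff_monomial, if_neg, map_zero, coeff_zero]
      intro hw
      apply hu
      ext l
      have h3 := DFunLike.congr_fun hw l
      simp only [Finsupp.add_apply, Finsupp.smul_apply, smul_eq_mul,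
          Finsupp.equivFunOnFinite_symm_apply_apply] at h3
      simp [h3, Nat.mod_eq_of_lt]
    · simp

theorem mem_map_iterateFrobenius [Finite σ] {J : Ideal (MvPolynomial σ k)}
    {h : MvPolynomial σ k}
    (hh : ∀ u : σ →₀ ℕ, (∀ l, u l < p ^ e) → frobComponent p e u h ∈ J) :
    h ∈ J.map (iterateFrobenius (MvPolynomial σ k) p e) := by
  classical
  cases nonempty_fintype σ
  rw [← sum_frobComponent_pow_mul p e h]
  refine Ideal.sum_mem _ fun u _ => Ideal.mul_mem_right _ _ ?_
  rw [← iterateFrobenius_def]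
  exact Ideal.mem_map_of_mem _ (hh _ fun l => by simp)

end FrobeniusComponents

theorem span_range_pow_le_span_range_pow {R : Type*} [CommRing R] {N : ℕ} (hN : 1 ≤ N)
    (g : Fin N → R) {q m : ℕ} (hq : 0 < q) (hm : 1 ≤ m) :
    Ideal.span (Set.range g) ^ (q * (N + m - 1)) ≤
      Ideal.span (Set.range fun l => g l ^ q) ^ m := by
  have h1 : Ideal.span (Set.range g) =
      (idealOfVars (Fin N) R).map (aeval g : MvPolynomial (Fin N) R →ₐ[R] R) := by
    rw [idealOfVars, Ideal.map_span, ← Set.range_comp]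
    congr 2
    ext l
    simp
  rw [h1, ← Ideal.map_pow, pow_idealOfVars_eq_span, Ideal.map_span, Ideal.span_le]
  rintro _ ⟨_, ⟨μ, hμ, rfl⟩, rfl⟩
  have hμ' : ∑ l, μ l = q * (N + m - 1) := by
    rw [← Finsupp.degree_eq_sum]; exact hμ
  have hsum : m ≤ ∑ l, μ l / q := by
    have h2 : ∑ l, μ l + N ≤ q * ∑ l, μ l / q + N * q := by
      calc ∑ l, μ l + N = ∑ l : Fin N, (μ l + 1) := by simp [Finset.sum_add_distrib]
        _ ≤ ∑ l : Fin N, (q * (μ l / q) + q) := Finset.sum_le_sum fun l _ => by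
          have h3 := Nat.div_add_mod (μ l) q
          have h4 := Nat.mod_lt (μ l) hq
          omega
        _ = _ := by simp [Finset.sum_add_distrib, Finset.mul_sum]
    obtain ⟨m, rfl⟩ := Nat.exists_eq_add_of_le' hm
    rw [hμ', show N + (m + 1) - 1 = N + m by omega] at h2
    by_contra! hc
    have h5 : q * ∑ l, μ l / q ≤ q * m := Nat.mul_le_mul_left _ (by omega)
    nlinarith
  refine Ideal.pow_le_pow_right hsum ?_
  beta_reduce
  rw [aeval_monomial, map_one, one_mul, Finsupp.prod_fintype _ _ (by simp),
    ← Finset.prod_pow_eq_pow_sum]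
  refine Ideal.prod_mem_prod fun l _ => ?_
  rw [← Nat.div_add_mod (μ l) q, pow_add, pow_mul, Nat.div_add_mod]
  exact Ideal.mul_mem_right _ _ (Ideal.pow_mem_pow (Ideal.subset_span (Set.mem_range_self l)) _)

theorem mem_iInf_pow_pow_of_charP {σ k ι : Type*} [Finite σ] [Field k] (p : ℕ) [Fact p.Prime]
    [CharP k p] [PerfectRing k p] {N : ℕ} (hN : 1 ≤ N) (g : ι → Fin N → MvPolynomial σ k)
    {t m : ℕ} (ht : 1 ≤ t) (hm : 1 ≤ m) {f : MvPolynomial σ k}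
    (hf : f ∈ ⨅ i, Ideal.span (Set.range (g i)) ^ (t * (N + m - 1))) :
    f ∈ (⨅ i, Ideal.span (Set.range (g i)) ^ m) ^ t := by
  set J := ⨅ i, Ideal.span (Set.range (g i)) ^ m with hJ
  by_cases hf0 : f = 0
  · rw [hf0]; exact zero_mem _
  have hg0 : f ^ (t - 1) ≠ 0 := pow_ne_zero _ hf0
  obtain ⟨e, he⟩ : ∃ e, (f ^ (t - 1)).totalDegree < p ^ e :=
    ⟨_, Nat.lt_pow_self (Fact.out : p.Prime).one_lt⟩
  have hq : 0 < p ^ e := pow_pos (Fact.out : p.Prime).pos e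
  set q := p ^ e with hqdef
  obtain ⟨b, hb1, hb2⟩ : ∃ b, q ≤ t * b ∧ t * b ≤ q + (t - 1) := by
    refine ⟨(q + (t - 1)) / t, ?_, Nat.mul_div_le _ _⟩
    have h1 := Nat.div_add_mod (q + (t - 1)) t
    have h2 := Nat.mod_lt (q + (t - 1)) ht
    omega
  have hfb : f ^ b ∈ J.map (iterateFrobenius (MvPolynomial σ k) p e) := by
    refine mem_map_iterateFrobenius p e fun u hu => ?_
    rw [hJ, Ideal.mem_iInf]
    intro i
    refine frobComponent_mem p e hu ?_
    rw [Ideal.map_pow, Ideal.map_span, ← Set.range_comp]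
    refine span_range_pow_le_span_range_pow hN (g i) hq hm ?_
    have h1 := Ideal.pow_mem_pow (Ideal.mem_iInf.1 hf i) b
    rw [← pow_mul] at h1
    refine Ideal.pow_le_pow_right ?_ h1
    calc q * (N + m - 1) ≤ t * b * (N + m - 1) := Nat.mul_le_mul_right _ hb1
      _ = _ := by ring
  have hft : f ^ q * f ^ (t - 1) ∈ (J ^ t).map (iterateFrobenius (MvPolynomial σ k) p e) := by
    rw [← pow_add, Ideal.map_pow]
    have h1 := Ideal.pow_mem_pow hfb t
    rw [← pow_mul, mul_comm] at h1
    obtain ⟨c, hc⟩ := Nat.exists_eq_add_of_le hb2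
    rw [hc, pow_add]
    exact Ideal.mul_mem_right _ _ h1
  obtain ⟨u, hu⟩ := (support_nonempty (p := f ^ (t - 1))).2 hg0
  have hlt : ∀ w ∈ (f ^ (t - 1)).support, ∀ l, w l < q := fun w hw l =>
    ((Finsupp.le_degree l w).trans (le_totalDegree hw)).trans_lt he
  have h2 := frobComponent_mem p e (hlt u hu) hft
  rw [frobComponent_pow_mul p e (hlt u hu)] at h2
  have h3 : frobComponent p e u (f ^ (t - 1)) =
      C ((iterateFrobeniusEquiv k p e).symm (coeff u (f ^ (t - 1)))) := by
    classical
    ext v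
    rw [coeff_frobComponent, coeff_C]
    split_ifs with hv
    · rw [← hv, smul_zero, zero_add]
    · rw [notMem_support_iff.1, map_zero]
      intro hmem
      apply hv
      ext l
      have h4 := hlt _ hmem l
      simp only [Finsupp.add_apply, Finsupp.smul_apply, smul_eq_mul] at h4
      by_contra h5
      have h6 : 1 ≤ v l := Nat.one_le_iff_ne_zero.2 fun h => h5 (by simp [h])
      nlinarith
  rw [h3] at h2
  rw [mem_support_iff] at hu
  have hunit : IsUnit (C ((iterateFrobeniusEquiv k p e).symm (coeff u (f ^ (t - 1)))) :
      MvPolynomial σ k) := by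
    refine IsUnit.map C (isUnit_iff_ne_zero.2 ?_)
    simpa using hu
  exact (Ideal.mul_unit_mem_iff_mem _ hunit).1 h2

attribute [local instance] MvPolynomial.gradedAlgebra

section PointIdeals

variable {A B : Type*} [CommRing A] [CommRing B] {N : ℕ}

/-- The ideal generated by the linear forms `x_l - p_l x_j` for `l ≠ j`. -/
def pointIdeal (p : Fin (N + 1) → A) (j : Fin (N + 1)) : Ideal (MvPolynomial (Fin (N + 1)) A) :=
  Ideal.span (Set.range fun l : Fin N => X (j.succAbove l) - C (p (j.succAbove l)) * X j)

/-- The linear substitution fixing `x_j` and sending `x_l` to `x_l + p_l x_j` for `l ≠ j`. -/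
def shift (p : Fin (N + 1) → A) (j : Fin (N + 1)) :
    MvPolynomial (Fin (N + 1)) A →ₐ[A] MvPolynomial (Fin (N + 1)) A :=
  aeval fun l => if l = j then X j else X l + C (p l) * X j

theorem shift_X_self (p : Fin (N + 1) → A) (j : Fin (N + 1)) : shift p j (X j) = X j := by
  simp [shift]

theorem shift_X_of_ne (p : Fin (N + 1) → A) {j l : Fin (N + 1)} (h : l ≠ j) :
    shift p j (X l) = X l + C (p l) * X j := by
  simp [shift, h]

theorem shift_neg_shift (p : Fin (N + 1) → A) (j : Fin (N + 1))
    (f : MvPolynomial (Fin (N + 1)) A) : shift (-p) j (shift p j f) = f := by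
  suffices (shift (-p) j).comp (shift p j) = AlgHom.id A _ from DFunLike.congr_fun this f
  ext1 l
  by_cases h : l = j
  · simp [h, shift_X_self]
  · simp [shift_X_of_ne _ h, shift_X_self]

theorem map_shift (φ : A →+* B) (p : Fin (N + 1) → A) (j : Fin (N + 1))
    (f : MvPolynomial (Fin (N + 1)) A) :
    map φ (shift p j f) = shift (φ ∘ p) j (map φ f) := by
  induction f using MvPolynomial.induction_on with
  | C a => simp
  | add f g hf hg => simp [hf, hg]
  | mul_X f l hf =>
    rw [map_mul, map_mul, hf, map_mul, map_mul, map_X]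
    by_cases h : l = j
    · simp [h, shift_X_self]
    · simp [shift_X_of_ne _ h]

theorem isHomogeneous_pointIdeal (p : Fin (N + 1) → A) (j : Fin (N + 1)) :
    (pointIdeal p j).IsHomogeneous (homogeneousSubmodule (Fin (N + 1)) A) := by
  refine Ideal.homogeneous_span _ _ ?_
  rintro _ ⟨l, rfl⟩
  refine ⟨1, ((isHomogeneous_X _ _).sub ?_ : IsHomogeneous _ _)⟩
  simpa using (isHomogeneous_C (Fin (N + 1)) (p (j.succAbove l))).mul (isHomogeneous_X A j)

theorem Ideal.IsHomogeneous.pow {σ : Type*} {I : Ideal (MvPolynomial σ A)}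
    (h : I.IsHomogeneous (homogeneousSubmodule σ A)) (m : ℕ) :
    (I ^ m).IsHomogeneous (homogeneousSubmodule σ A) := by
  induction m with
  | zero => rw [pow_zero, Ideal.one_eq_top]; exact Ideal.IsHomogeneous.top _
  | succ m ih => rw [pow_succ]; exact ih.mul h

/-- The degree of a monomial in the variables other than `x_j`. -/
def offDegree (j : Fin (N + 1)) (μ : Fin (N + 1) →₀ ℕ) : ℕ := ∑ l : Fin N, μ (j.succAbove l)

theorem offDegree_add (j : Fin (N + 1)) (μ ν : Fin (N + 1) →₀ ℕ) :
    offDegree j (μ + ν) = offDegree j μ + offDegree j ν := by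
  simp [offDegree, Finset.sum_add_distrib]

variable (A) in
/-- Polynomials all of whose monomials have degree at least `m` outside `x_j`. -/
def offIdeal (j : Fin (N + 1)) (m : ℕ) : Ideal (MvPolynomial (Fin (N + 1)) A) where
  carrier := {f | ∀ μ, offDegree j μ < m → coeff μ f = 0}
  zero_mem' := fun μ _ => coeff_zero μ
  add_mem' := fun hf hg μ hμ => by rw [coeff_add, hf μ hμ, hg μ hμ, add_zero]
  smul_mem' := fun c f hf μ hμ => by
    classical
    rw [smul_eq_mul, coeff_mul]
    refine Finset.sum_eq_zero fun x hx => ?_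
    rw [Finset.HasAntidiagonal.mem_antidiagonal] at hx
    rw [← hx, offDegree_add] at hμ
    rw [hf x.2 (by omega), mul_zero]

theorem mem_offIdeal {j : Fin (N + 1)} {m : ℕ} {f : MvPolynomial (Fin (N + 1)) A} :
    f ∈ offIdeal A j m ↔ ∀ μ, offDegree j μ < m → coeff μ f = 0 := Iff.rfl

theorem offIdeal_mul_le (j : Fin (N + 1)) (a b : ℕ) :
    offIdeal A j a * offIdeal A j b ≤ offIdeal A j (a + b) := by
  classical
  refine Ideal.mul_le.2 fun f hf g hg μ hμ => ?_
  rw [coeff_mul]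
  refine Finset.sum_eq_zero fun x hx => ?_
  rw [Finset.HasAntidiagonal.mem_antidiagonal] at hx
  rw [← hx, offDegree_add] at hμ
  by_cases h : offDegree j x.1 < a
  · rw [hf _ h, zero_mul]
  · rw [hg x.2 (by omega), mul_zero]

theorem span_X_succAbove_pow (j : Fin (N + 1)) (m : ℕ) :
    Ideal.span (Set.range fun l : Fin N => (X (j.succAbove l) : MvPolynomial (Fin (N + 1)) A)) ^ m
      = offIdeal A j m := by
  classical
  refine le_antisymm ?_ fun f hf => ?_
  · induction m with
    | zero => exact fun f _ μ hμ => absurd hμ (Nat.not_lt_zero _)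
    | succ m ih =>
      rw [pow_succ]
      refine (Ideal.mul_mono ih ?_).trans (offIdeal_mul_le j m 1)
      rw [Ideal.span_le]
      rintro _ ⟨l, rfl⟩ μ hμ
      rw [coeff_X, if_neg]
      rintro rfl
      have h1 : offDegree j (Finsupp.single (j.succAbove l) 1) = 1 := by
        simp [offDegree, Finsupp.single_apply]
      omega
  · rw [f.as_sum]
    refine Ideal.sum_mem _ fun μ hμ => ?_
    have h1 : m ≤ offDegree j μ := by
      by_contra! hc
      exact (mem_support_iff.1 hμ) (hf μ hc)
    refine Ideal.pow_le_pow_right h1 ?_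
    rw [monomial_eq, Finsupp.prod_fintype _ _ (by simp), Fin.prod_univ_succAbove _ j]
    refine Ideal.mul_mem_left _ _ (Ideal.mul_mem_left _ _ ?_)
    rw [offDegree, ← Finset.prod_pow_eq_pow_sum]
    exact Ideal.prod_mem_prod fun l _ =>
      Ideal.pow_mem_pow (Ideal.subset_span (Set.mem_range_self l)) _

theorem mem_pointIdeal_pow_iff {p : Fin (N + 1) → A} {j : Fin (N + 1)} {m : ℕ}
    {f : MvPolynomial (Fin (N + 1)) A} :
    f ∈ pointIdeal p j ^ m ↔ ∀ μ, offDegree j μ < m → coeff μ (shift p j f) = 0 := by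
  rw [← mem_offIdeal, ← span_X_succAbove_pow]
  set V := Ideal.span
    (Set.range fun l : Fin N => (X (j.succAbove l) : MvPolynomial (Fin (N + 1)) A))
  have h1 : (pointIdeal p j).map (shift p j) = V := by
    rw [pointIdeal, Ideal.map_span, ← Set.range_comp]
    congr 2
    ext1 l
    simp [shift_X_of_ne _ (Fin.succAbove_ne j l), shift_X_self]
  have h2 : V.map (shift (-p) j) = pointIdeal p j := by
    rw [pointIdeal, Ideal.map_span, ← Set.range_comp]
    congr 2
    ext1 l
    simp [shift_X_of_ne _ (Fin.succAbove_ne j l), sub_eq_add_neg]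
  refine ⟨fun h => ?_, fun h => ?_⟩
  · rw [← h1, ← Ideal.map_pow]
    exact Ideal.mem_map_of_mem _ h
  · rw [← h2, ← Ideal.map_pow, ← shift_neg_shift p j f]
    exact Ideal.mem_map_of_mem _ h

theorem totalDegree_shift_le (p : Fin (N + 1) → A) (j : Fin (N + 1))
    (f : MvPolynomial (Fin (N + 1)) A) : (shift p j f).totalDegree ≤ f.totalDegree := by
  conv_lhs => rw [f.as_sum, map_sum]
  refine totalDegree_finsetSum_le fun μ hμ => ?_
  have h1 : (shift p j (monomial μ (coeff μ f))).IsHomogeneous (1 * μ.degree) := by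
    refine (isHomogeneous_monomial _ rfl).aeval _ fun l => ?_
    split_ifs
    · exact isHomogeneous_X _ _
    · refine (isHomogeneous_X _ _).add ?_
      simpa using (isHomogeneous_C (Fin (N + 1)) (p l)).mul (isHomogeneous_X A j)
  rw [one_mul] at h1
  exact h1.totalDegree_le.trans (le_totalDegree hμ)

end PointIdeals

section LinearAlgebra

variable {A B : Type*} [CommRing A] [CommRing B] {N n : ℕ}

/-- The intersection of the `m`-th powers of the ideals `pointIdeal (p i) (j i)`. -/
def pointSymbPow (p : Fin n → Fin (N + 1) → A) (j : Fin n → Fin (N + 1)) (m : ℕ) :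
    Ideal (MvPolynomial (Fin (N + 1)) A) :=
  ⨅ i, pointIdeal (p i) (j i) ^ m

theorem mem_pointSymbPow_iff {p : Fin n → Fin (N + 1) → A} {j : Fin n → Fin (N + 1)} {m : ℕ}
    {f : MvPolynomial (Fin (N + 1)) A} :
    f ∈ pointSymbPow p j m ↔
      ∀ i μ, offDegree (j i) μ < m → coeff μ (shift (p i) (j i) f) = 0 := by
  simp only [pointSymbPow, Ideal.mem_iInf, mem_pointIdeal_pow_iff]

theorem isHomogeneous_pointSymbPow (p : Fin n → Fin (N + 1) → A) (j : Fin n → Fin (N + 1))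
    (m : ℕ) : (pointSymbPow p j m).IsHomogeneous (homogeneousSubmodule (Fin (N + 1)) A) :=
  Ideal.IsHomogeneous.iInf fun i => (isHomogeneous_pointIdeal (p i) (j i)).pow m

theorem map_mem_pointSymbPow (φ : A →+* B) {p : Fin n → Fin (N + 1) → A}
    {j : Fin n → Fin (N + 1)} {m : ℕ} {f : MvPolynomial (Fin (N + 1)) A}
    (hf : f ∈ pointSymbPow p j m) : map φ f ∈ pointSymbPow (fun i => φ ∘ p i) j m := by
  rw [mem_pointSymbPow_iff] at hf ⊢
  intro i μ hμ
  rw [← map_shift, coeff_map, hf i μ hμ, map_zero]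

theorem map_mem_pointSymbPow_iff {φ : A →+* B} (hφ : Function.Injective φ)
    {p : Fin n → Fin (N + 1) → A} {j : Fin n → Fin (N + 1)} {m : ℕ}
    {f : MvPolynomial (Fin (N + 1)) A} :
    map φ f ∈ pointSymbPow (fun i => φ ∘ p i) j m ↔ f ∈ pointSymbPow p j m := by
  refine ⟨fun hf => ?_, map_mem_pointSymbPow φ⟩
  rw [mem_pointSymbPow_iff] at hf ⊢
  intro i μ hμ
  have h1 := hf i μ hμ
  rwa [← map_shift, coeff_map, map_eq_zero_iff φ hφ] at h1

/-- Exponents of monomials in `N + 1` variables of degree at most `d`. -/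
abbrev Exponents (N d : ℕ) : Type := {μ : Fin (N + 1) →₀ ℕ // μ.degree ≤ d}

instance (N d : ℕ) : Fintype (Exponents N d) :=
  (Finsupp.finite_of_degree_le d).fintype

/-- The polynomial with coefficient vector `v`. -/
def polyOfCoeffs {d : ℕ} (v : Exponents N d → A) : MvPolynomial (Fin (N + 1)) A :=
  ∑ ν, monomial ν.1 (v ν)

theorem coeff_polyOfCoeffs {d : ℕ} (v : Exponents N d → A) (ν : Exponents N d) :
    coeff ν.1 (polyOfCoeffs v) = v ν := by
  classical
  simp [polyOfCoeffs, coeff_sum, coeff_monomial, Subtype.val_inj]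

theorem totalDegree_polyOfCoeffs_le {d : ℕ} (v : Exponents N d → A) :
    (polyOfCoeffs v).totalDegree ≤ d :=
  totalDegree_finsetSum_le fun ν _ =>
    (isHomogeneous_monomial _ rfl).totalDegree_le.trans ν.2

theorem polyOfCoeffs_coeff {d : ℕ} {f : MvPolynomial (Fin (N + 1)) A} (hf : f.totalDegree ≤ d) :
    polyOfCoeffs (fun ν : Exponents N d => coeff ν.1 f) = f := by
  classical
  ext μ
  by_cases hμ : μ.degree ≤ d
  · exact coeff_polyOfCoeffs (fun ν : Exponents N d => coeff ν.1 f) ⟨μ, hμ⟩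
  · push Not at hμ
    rw [coeff_eq_zero_of_totalDegree_lt, coeff_eq_zero_of_totalDegree_lt]
    · exact hf.trans_lt hμ
    · exact (totalDegree_polyOfCoeffs_le _).trans_lt hμ

theorem map_polyOfCoeffs (φ : A →+* B) {d : ℕ} (v : Exponents N d → A) :
    map φ (polyOfCoeffs v) = polyOfCoeffs (φ ∘ v) := by
  simp [polyOfCoeffs, map_monomial]

/-- The matrix of the linear conditions on the coefficients of a polynomial of degree at most `d`
expressing membership in `pointSymbPow p j m`. -/
def condMatrix (p : Fin n → Fin (N + 1) → A) (j : Fin n → Fin (N + 1)) (m d : ℕ) :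
    Matrix (Fin n × Exponents N d) (Exponents N d) A :=
  Matrix.of fun x ν =>
    if offDegree (j x.1) x.2.1 < m then coeff x.2.1 (shift (p x.1) (j x.1) (monomial ν.1 1)) else 0

theorem condMatrix_map (φ : A →+* B) (p : Fin n → Fin (N + 1) → A) (j : Fin n → Fin (N + 1))
    (m d : ℕ) :
    (condMatrix p j m d).map φ = condMatrix (fun i => φ ∘ p i) j m d := by
  ext x ν
  simp only [condMatrix, Matrix.map_apply, Matrix.of_apply]
  split_ifs
  · rw [← coeff_map, map_shift, map_monomial, map_one]
  · exact map_zero φ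

theorem condMatrix_mulVec_eq_zero_iff {p : Fin n → Fin (N + 1) → A} {j : Fin n → Fin (N + 1)}
    {m d : ℕ} {v : Exponents N d → A} :
    Matrix.mulVec (condMatrix p j m d) v = 0 ↔ polyOfCoeffs v ∈ pointSymbPow p j m := by
  have key : ∀ x, Matrix.mulVec (condMatrix p j m d) v x =
      if offDegree (j x.1) x.2.1 < m then
        coeff x.2.1 (shift (p x.1) (j x.1) (polyOfCoeffs v)) else 0 := fun x => by
    simp only [Matrix.mulVec, dotProduct, condMatrix, Matrix.of_apply]
    split_ifs
    · rw [polyOfCoeffs, map_sum, coeff_sum]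
      refine Finset.sum_congr rfl fun ν _ => ?_
      rw [show monomial ν.1 (v ν) = v ν • monomial ν.1 (1 : A) by
        rw [smul_monomial, smul_eq_mul, mul_one], map_smul, coeff_smul, smul_eq_mul, mul_comm]
    · simp
  rw [mem_pointSymbPow_iff]
  constructor
  · intro h i μ hμ
    by_cases hd : μ.degree ≤ d
    · have h1 := congrFun h (i, ⟨μ, hd⟩)
      rwa [key, if_pos hμ] at h1
    · push Not at hd
      exact coeff_eq_zero_of_totalDegree_lt (((totalDegree_shift_le _ _ _).trans
        (totalDegree_polyOfCoeffs_le v)).trans_lt hd)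
  · intro h
    ext x
    rw [key]
    split_ifs with hx
    · exact h _ _ hx
    · rfl

theorem mem_map_pointSymbPow (φ : A →+* B) {p : Fin n → Fin (N + 1) → A}
    {j : Fin n → Fin (N + 1)} {m d : ℕ} {G : Matrix (Exponents N d) (Fin n × Exponents N d) A}
    (hG : condMatrix p j m d * G * condMatrix p j m d = condMatrix p j m d)
    {h : MvPolynomial (Fin (N + 1)) B} (hh : h ∈ pointSymbPow (fun i => φ ∘ p i) j m)
    (hd : h.totalDegree ≤ d) :
    h ∈ (pointSymbPow p j m).map (map φ) := by
  classical
  set M := condMatrix p j m d with hM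
  set E : Matrix (Exponents N d) (Exponents N d) A := 1 - G * M with hE
  have hME : M * E = 0 := by
    rw [hE, Matrix.mul_sub, Matrix.mul_one, ← Matrix.mul_assoc, hG, sub_self]
  set v : Exponents N d → B := fun ν => coeff ν.1 h with hv
  have hpv : polyOfCoeffs v = h := polyOfCoeffs_coeff hd
  have hMv : Matrix.mulVec (M.map φ) v = 0 := by
    rw [hM, condMatrix_map, condMatrix_mulVec_eq_zero_iff, hpv]
    exact hh
  have hEv : Matrix.mulVec (E.map φ) v = v := by
    have h1 : E.map φ = 1 - G.map φ * M.map φ := by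
      rw [hE, ← Matrix.map_mul, Matrix.map_sub φ (map_sub φ),
        Matrix.map_one φ (map_zero φ) (map_one φ)]
    rw [h1, Matrix.sub_mulVec, Matrix.one_mulVec, ← Matrix.mulVec_mulVec, hMv,
      Matrix.mulVec_zero, sub_zero]
  have hsum : h = ∑ ν, C (v ν) * map φ (polyOfCoeffs fun μ => E μ ν) := by
    conv_lhs => rw [← hpv, ← hEv]
    simp only [polyOfCoeffs, Matrix.mulVec, dotProduct, Matrix.map_apply, map_sum, map_monomial,
      Finset.mul_sum, C_mul_monomial]
    rw [Finset.sum_comm]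
    simp only [mul_comm]
  rw [hsum]
  refine Ideal.sum_mem _ fun ν _ => Ideal.mul_mem_left _ _ (Ideal.mem_map_of_mem _ ?_)
  rw [← condMatrix_mulVec_eq_zero_iff]
  ext x
  exact congrFun (congrFun hME x) ν

theorem Matrix.exists_mul_mul_eq_self {K m n : Type*} [Field K] [Fintype m] [Fintype n]
    (M : Matrix m n K) : ∃ G : Matrix n m K, M * G * M = M := by
  classical
  set f := Matrix.toLin' M with hf
  obtain ⟨s, hs⟩ := f.rangeRestrict.exists_rightInverse_of_surjective f.range_rangeRestrict
  obtain ⟨g, hg⟩ := LinearMap.exists_extend s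
  refine ⟨LinearMap.toMatrix' g, Matrix.toLin'.injective ?_⟩
  rw [Matrix.toLin'_mul, Matrix.toLin'_mul, Matrix.toLin'_toMatrix', ← hf]
  refine LinearMap.ext fun v => ?_
  have h1 := DFunLike.congr_fun hg (f.rangeRestrict v)
  have h2 := congrArg Subtype.val (DFunLike.congr_fun hs (f.rangeRestrict v))
  simp only [LinearMap.comp_apply, Submodule.subtype_apply, LinearMap.id_apply] at h1 h2
  simp only [LinearMap.comp_apply]
  exact (congrArg f h1).trans h2

end LinearAlgebra

theorem le_sup_pow_of_totalDegree_le {σ A : Type*} [CommRing A] {I J : Ideal (MvPolynomial σ A)}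
    (hI : I.IsHomogeneous (homogeneousSubmodule σ A)) (d : ℕ)
    (h : ∀ f ∈ I, f.totalDegree ≤ d → f ∈ J) : I ≤ J ⊔ idealOfVars σ A ^ (d + 1) := by
  intro f hf
  rw [← sum_homogeneousComponent f]
  refine Ideal.sum_mem _ fun e _ => ?_
  by_cases he : e ≤ d
  · exact Ideal.mem_sup_left (h _ (homogeneousComponent_mem_of_mem hI hf e)
      ((homogeneousComponent_isHomogeneous e f).totalDegree_le.trans he))
  · refine Ideal.mem_sup_right ((mem_pow_idealOfVars_iff' _ _).2 fun μ hμ => ?_)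
    rw [coeff_homogeneousComponent, if_neg (by omega)]

theorem Ideal.sup_pow_le_pow_sup {R : Type*} [CommRing R] (I J : Ideal R) (t : ℕ) :
    (I ⊔ J) ^ t ≤ I ^ t ⊔ J := by
  induction t with
  | zero => simp
  | succ t ih =>
    rw [pow_succ, pow_succ]
    refine (Ideal.mul_mono_left ih).trans ?_
    rw [Ideal.sup_mul, Ideal.mul_sup]
    exact sup_le (sup_le le_sup_left (Ideal.mul_le_right.trans le_sup_right))
      (Ideal.mul_le_left.trans le_sup_right)

theorem Int.isJacobsonRing : IsJacobsonRing ℤ := by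
  rw [isJacobsonRing_iff_sInf_maximal']
  intro I hI
  rcases eq_or_ne I ⊥ with rfl | hI0
  · refine ⟨{J | J.IsMaximal}, fun J hJ => hJ.1.2, ?_⟩
    symm
    rw [eq_bot_iff]
    intro x hx
    rw [Submodule.mem_sInf] at hx
    obtain ⟨q, hq1, hq⟩ := Nat.exists_infinite_primes (x.natAbs + 1)
    have hmax : (Ideal.span {(q : ℤ)}).IsMaximal :=
      PrincipalIdealRing.isMaximal_of_irreducible (Nat.prime_iff_prime_int.1 hq).irreducible
    have h1 := Ideal.mem_span_singleton.1 (hx _ hmax)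
    exact Int.eq_zero_of_abs_lt_dvd h1 (by rw [Int.abs_eq_natAbs]; omega)
  · exact ⟨{I}, fun J hJ => by rw [Set.mem_singleton_iff.1 hJ]; exact (hI.isMaximal hI0).1.2,
      sInf_singleton.symm⟩

theorem exists_charP_finite_of_finiteType_int (k : Type*) [Field k] [Algebra.FiniteType ℤ k] :
    ∃ p : ℕ, p.Prime ∧ CharP k p ∧ Finite k := by
  have := Int.isJacobsonRing
  have hfin : Module.Finite ℤ k := finite_of_finite_type_of_isJacobsonRing ℤ k
  obtain ⟨p, hp⟩ := CharP.exists k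
  rcases CharP.char_is_prime_or_zero k p with hprime | rfl
  · refine ⟨p, hprime, hp, ?_⟩
    have := Fact.mk hprime
    let := ZMod.algebra k p
    have : Module.Finite (ZMod p) k := Module.Finite.of_restrictScalars_finite ℤ (ZMod p) k
    exact Module.finite_of_finite (ZMod p)
  · have := CharP.charP_to_charZero k
    exact absurd (isField_of_isIntegral_of_isField (R := ℤ) (S := k)
      (algebraMap ℤ k).injective_int (Field.toIsField k)) Int.not_isField

theorem exists_charP_finite_of_surjective {A k : Type*} [CommRing A] [Field k]
    [Algebra.FiniteType ℤ A] {π : A →+* k} (hπ : Function.Surjective π) :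
    ∃ p : ℕ, p.Prime ∧ CharP k p ∧ Finite k := by
  have : Algebra.FiniteType ℤ k := Algebra.FiniteType.of_surjective π.toIntAlgHom hπ
  exact exists_charP_finite_of_finiteType_int k

theorem exists_subring_hom_finite_field.{u} {K : Type u} [Field K] {S : Set K} (hS : S.Finite) :
    ∃ A : Subring K, S ⊆ A ∧ ∃ (k : Type u) (_ : Field k) (π : A →+* k) (p : ℕ),
      Function.Surjective π ∧ p.Prime ∧ CharP k p ∧ Finite k := by
  set A := Algebra.adjoin ℤ S
  have : Algebra.FiniteType ℤ A :=
    A.fg_iff_finiteType.1 (Subalgebra.fg_def.2 ⟨S, hS, rfl⟩)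
  refine ⟨A.toSubring, Algebra.subset_adjoin, ?_⟩
  obtain ⟨I, hI⟩ := Ideal.exists_maximal A
  let := Ideal.Quotient.field I
  have hπ : Function.Surjective (Ideal.Quotient.mk I) := Ideal.Quotient.mk_surjective
  obtain ⟨p, hp⟩ := exists_charP_finite_of_surjective hπ
  exact ⟨A ⧸ I, inferInstance, Ideal.Quotient.mk I, p, hπ, hp⟩

theorem pointSymbPow_le_pow_of_charP {k : Type*} [Field k] (p : ℕ) [Fact p.Prime]
    [CharP k p] [PerfectRing k p] {N n : ℕ} (hN : 1 ≤ N) (P : Fin n → Fin (N + 1) → k)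
    (j : Fin n → Fin (N + 1)) {t m : ℕ} (ht : 1 ≤ t) (hm : 1 ≤ m) :
    pointSymbPow P j (t * (N + m - 1)) ≤ pointSymbPow P j m ^ t :=
  fun _ hf => mem_iInf_pow_pow_of_charP p hN _ ht hm hf

/-- A linear functional on polynomials of degree at most `d` over `A` which vanishes on the power
`pointSymbPow p j m ^ t` cannot take the value `1` on the symbolic power of order
`t * (N + m - 1)`, provided `A` surjects onto a perfect field of positive characteristic. -/
theorem sum_mul_ne_one_of_surjective {A k : Type*} [CommRing A] [Field k] (q : ℕ) [Fact q.Prime]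
    [CharP k q] [PerfectRing k q] {π : A →+* k} (hπ : Function.Surjective π) {N n : ℕ}
    (hN : 1 ≤ N) {p : Fin n → Fin (N + 1) → A} {j : Fin n → Fin (N + 1)} {t m d : ℕ}
    (ht : 1 ≤ t) (hm : 1 ≤ m) {G : Matrix (Exponents N d) (Fin n × Exponents N d) A}
    (hG : condMatrix p j m d * G * condMatrix p j m d = condMatrix p j m d)
    {v w : Exponents N d → A} (hv : polyOfCoeffs v ∈ pointSymbPow p j (t * (N + m - 1)))
    (hw : ∀ g ∈ pointSymbPow p j m ^ t, ∑ ν : Exponents N d, w ν * coeff ν.1 g = 0) :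
    ∑ ν, w ν * v ν ≠ 1 := by
  intro hcon
  have hfk := pointSymbPow_le_pow_of_charP q hN _ j ht hm (map_mem_pointSymbPow π hv)
  have hle : pointSymbPow (fun i => π ∘ p i) j m ≤
      (pointSymbPow p j m).map (map π) ⊔ idealOfVars (Fin (N + 1)) k ^ (d + 1) :=
    le_sup_pow_of_totalDegree_le (isHomogeneous_pointSymbPow _ j m) d fun h hh hd =>
      mem_map_pointSymbPow π hG hh hd
  have hfk' := (Ideal.pow_right_mono hle t).trans (Ideal.sup_pow_le_pow_sup _ _ t) hfk
  rw [← Ideal.map_pow] at hfk'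
  obtain ⟨a, ha, r, hr, har⟩ := Submodule.mem_sup.1 hfk'
  obtain ⟨g, hg, rfl⟩ := (Ideal.mem_map_iff_of_surjective _ (map_surjective π hπ)).1 ha
  have hcoeff : ∀ ν : Exponents N d, π (coeff ν.1 g) = π (v ν) := fun ν => by
    have h1 := congrArg (coeff ν.1) har
    rwa [coeff_add, (mem_pow_idealOfVars_iff' _ _).1 hr ν.1 (Nat.lt_succ_of_le ν.2), add_zero,
      coeff_map, coeff_map, coeff_polyOfCoeffs] at h1
  have h0 := congrArg π (hw g hg)
  have h1 := congrArg π hcon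
  simp only [map_sum, map_mul, map_one, map_zero, hcoeff] at h0 h1
  exact zero_ne_one (h0.symm.trans h1)

theorem mem_pointSymbPow_pow_of_isHomogeneous {K : Type*} [Field K] {N n : ℕ} (hN : 1 ≤ N)
    (P : Fin n → Fin (N + 1) → K) (j : Fin n → Fin (N + 1)) {t m d : ℕ} (ht : 1 ≤ t) (hm : 1 ≤ m)
    {f : MvPolynomial (Fin (N + 1)) K} (hfd : f.IsHomogeneous d)
    (hf : f ∈ pointSymbPow P j (t * (N + m - 1))) :
    f ∈ pointSymbPow P j m ^ t := by
  by_contra hcon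
  have hJhom := (isHomogeneous_pointSymbPow P j m).pow t
  set Q : Ideal (MvPolynomial (Fin (N + 1)) K) :=
    pointSymbPow P j m ^ t ⊔ idealOfVars (Fin (N + 1)) K ^ (d + 1) with hQ
  have hfQ : f ∉ Q.restrictScalars K := by
    intro h
    obtain ⟨a, ha, r, hr, har⟩ := Submodule.mem_sup.1 (show f ∈ Q from h)
    apply hcon
    have h1 := congrArg (homogeneousComponent d) har
    rw [map_add, homogeneousComponent_of_mem hfd, if_pos rfl] at h1
    have h2 : homogeneousComponent d r = 0 := by
      ext μ
      rw [coeff_homogeneousComponent, coeff_zero]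
      split_ifs with hμ
      · exact (mem_pow_idealOfVars_iff' _ _).1 hr μ (by omega)
      · rfl
    rw [← h1, h2, add_zero]
    exact homogeneousComponent_mem_of_mem hJhom ha d
  obtain ⟨L₀, hL₀f, hL₀⟩ := Submodule.exists_le_ker_of_notMem hfQ
  set L := (L₀ f)⁻¹ • L₀ with hL
  have hLf : L f = 1 := by simp [hL, hL₀f]
  have hLQ : ∀ g ∈ Q, L g = 0 := fun g hg => by
    have : L₀ g = 0 := hL₀ hg
    simp [hL, this]
  have hLsum : ∀ g, L g = ∑ ν : Exponents N d, L (monomial ν.1 1) * coeff ν.1 g := fun g => by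
    have h1 : g - polyOfCoeffs (fun ν : Exponents N d => coeff ν.1 g) ∈ Q := by
      refine Ideal.mem_sup_right ((mem_pow_idealOfVars_iff' _ _).2 fun μ hμ => ?_)
      rw [coeff_sub, sub_eq_zero]
      exact (coeff_polyOfCoeffs (fun ν : Exponents N d => coeff ν.1 g) ⟨μ, by omega⟩).symm
    have h2 := hLQ _ h1
    rw [map_sub, sub_eq_zero] at h2
    rw [h2, polyOfCoeffs, map_sum]
    refine Finset.sum_congr rfl fun ν _ => ?_
    rw [show monomial ν.1 (coeff ν.1 g) = coeff ν.1 g • monomial ν.1 (1 : K) by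
      rw [smul_monomial, smul_eq_mul, mul_one], map_smul, smul_eq_mul, mul_comm]
  obtain ⟨G, hG⟩ := (condMatrix P j m d).exists_mul_mul_eq_self
  set S : Set K := Set.range (fun x : Fin n × Fin (N + 1) => P x.1 x.2) ∪
    Set.range (fun x : Exponents N d × (Fin n × Exponents N d) => G x.1 x.2) ∪
    Set.range (fun ν : Exponents N d => coeff ν.1 f) ∪
    Set.range (fun ν : Exponents N d => L (monomial ν.1 1)) with hS
  have hSfin : S.Finite := by
    refine Set.Finite.union (Set.Finite.union (Set.Finite.union ?_ ?_) ?_) ?_ <;>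
      exact Set.finite_range _
  obtain ⟨A, hSA, k, _, π, p, hπsurj, hp, hchar, hfin⟩ := exists_subring_hom_finite_field hSfin
  have := Fact.mk hp
  have hιinj : Function.Injective A.subtype := Subtype.val_injective
  obtain ⟨PA, hPA⟩ : ∃ PA : Fin n → Fin (N + 1) → A, (fun i => A.subtype ∘ PA i) = P :=
    ⟨fun i l => ⟨P i l, hSA (Or.inl (Or.inl (Or.inl ⟨(i, l), rfl⟩)))⟩, rfl⟩
  obtain ⟨GA, rfl⟩ : ∃ GA : Matrix (Exponents N d) (Fin n × Exponents N d) A,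
      GA.map A.subtype = G :=
    ⟨Matrix.of fun μ x => ⟨G μ x, hSA (Or.inl (Or.inl (Or.inr ⟨(μ, x), rfl⟩)))⟩, rfl⟩
  obtain ⟨v, hv⟩ : ∃ v : Exponents N d → A, ∀ ν, A.subtype (v ν) = coeff ν.1 f :=
    ⟨fun ν => ⟨coeff ν.1 f, hSA (Or.inl (Or.inr ⟨ν, rfl⟩))⟩, fun _ => rfl⟩
  obtain ⟨w, hw⟩ : ∃ w : Exponents N d → A, ∀ ν, A.subtype (w ν) = L (monomial ν.1 1) :=
    ⟨fun ν => ⟨L (monomial ν.1 1), hSA (Or.inr ⟨ν, rfl⟩)⟩, fun _ => rfl⟩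
  have hGA : condMatrix PA j m d * GA * condMatrix PA j m d = condMatrix PA j m d := by
    refine Matrix.map_injective hιinj ?_
    simp only [Matrix.map_mul, condMatrix_map, hPA]
    exact hG
  have hvf : map A.subtype (polyOfCoeffs v) = f := by
    rw [map_polyOfCoeffs, show A.subtype ∘ v = fun ν => coeff ν.1 f from funext hv]
    exact polyOfCoeffs_coeff hfd.totalDegree_le
  have hvmem : polyOfCoeffs v ∈ pointSymbPow PA j (t * (N + m - 1)) := by
    rw [← map_mem_pointSymbPow_iff hιinj, hvf, hPA]
    exact hf
  refine sum_mul_ne_one_of_surjective p hπsurj hN ht hm hGA hvmem (w := w) (fun g hg => ?_) ?_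
  · have hle : (pointSymbPow PA j m).map (map A.subtype) ≤ pointSymbPow P j m := by
      rw [← hPA]
      exact Ideal.map_le_iff_le_comap.2 fun x hx => map_mem_pointSymbPow A.subtype hx
    have h1 : map A.subtype g ∈ pointSymbPow P j m ^ t := by
      have h2 := Ideal.mem_map_of_mem (map A.subtype) hg
      rw [Ideal.map_pow] at h2
      exact Ideal.pow_right_mono hle t h2
    have h3 := hLQ _ (Ideal.mem_sup_left h1)
    rw [hLsum] at h3
    apply hιinj
    simp only [map_zero, map_sum, map_mul, hw, ← coeff_map, h3]
  · apply hιinj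
    simp only [map_one, map_sum, map_mul, hw, hv]
    rw [← hLsum, hLf]

theorem derivation_mem_pow {R A : Type*} [CommRing R] [CommRing A] [Algebra R A]
    (D : Derivation R A A) (I : Ideal A) (m : ℕ) {f : A} (hf : f ∈ I ^ (m + 1)) : D f ∈ I ^ m := by
  induction m generalizing f with
  | zero => simp
  | succ m ih =>
    rw [pow_succ] at hf
    induction hf using Submodule.mul_induction_on' with
    | mem_mul_mem a ha b hb =>
      rw [Derivation.leibniz, smul_eq_mul, smul_eq_mul]
      refine add_mem (Ideal.mul_mem_right _ _ ha) ?_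
      rw [pow_succ']
      exact Ideal.mul_mem_mul hb (ih ha)
    | add a _ b _ ha hb => rw [map_add]; exact add_mem ha hb

theorem le_of_isHomogeneous_imp_mem {σ A : Type*} [CommRing A] {I J : Ideal (MvPolynomial σ A)}
    (hI : I.IsHomogeneous (homogeneousSubmodule σ A))
    (h : ∀ f ∈ I, ∀ d, f.IsHomogeneous d → f ∈ J) : I ≤ J := by
  intro f hf
  rw [← sum_homogeneousComponent f]
  exact Ideal.sum_mem _ fun e _ => h _ (homogeneousComponent_mem_of_mem hI hf e) e
    (homogeneousComponent_isHomogeneous e f)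

theorem isHomogeneous_homVanishingIdeal {K σ : Type*} [Field K] (p : σ → K) :
    (homVanishingIdeal p).IsHomogeneous (homogeneousSubmodule σ K) :=
  Ideal.homogeneous_span _ _ fun _ hF => hF.1

theorem isHomogeneous_symbPow {K σ ι : Type*} [Field K] (P : ι → σ → K) (m : ℕ) :
    (symbPow P m).IsHomogeneous (homogeneousSubmodule σ K) :=
  Ideal.IsHomogeneous.iInf fun i => (isHomogeneous_homVanishingIdeal (P i)).pow m

theorem eval_eq_zero_of_mem_homVanishingIdeal {K σ : Type*} [Field K] {p : σ → K}
    {f : MvPolynomial σ K} (hf : f ∈ homVanishingIdeal p) : eval p f = 0 := by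
  have h : homVanishingIdeal p ≤ RingHom.ker (eval p) :=
    Ideal.span_le.2 fun F hF => hF.2
  exact h hf

theorem symbPow_succ_le {K σ ι : Type*} [Field K] [CharZero K] [Fintype σ] [Nonempty ι]
    (P : ι → σ → K) (m : ℕ) : symbPow P (m + 1) ≤ irrel K σ * symbPow P m := by
  refine le_of_isHomogeneous_imp_mem (isHomogeneous_symbPow P _) fun f hf d hd => ?_
  rw [symbPow, Ideal.mem_iInf] at hf
  rcases Nat.eq_zero_or_pos d with rfl | hd0
  · obtain ⟨i⟩ := ‹Nonempty ι›
    have h1 := eval_eq_zero_of_mem_homVanishingIdeal (Ideal.pow_le_self (Nat.succ_ne_zero m) (hf i))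
    rw [totalDegree_eq_zero_iff_eq_C.1 (Nat.le_zero.1 hd.totalDegree_le), eval_C] at h1
    rw [totalDegree_eq_zero_iff_eq_C.1 (Nat.le_zero.1 hd.totalDegree_le), h1, C_0]
    exact zero_mem _
  · have h2 : d • f ∈ irrel K σ * symbPow P m := by
      rw [← hd.sum_X_mul_pderiv]
      refine Ideal.sum_mem _ fun l _ =>
        Ideal.mul_mem_mul (Ideal.subset_span (Set.mem_range_self l)) ?_
      rw [symbPow, Ideal.mem_iInf]
      exact fun i => derivation_mem_pow _ _ _ (hf i)
    have h3 : IsUnit ((d : ℕ) : MvPolynomial σ K) := by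
      rw [← map_natCast (C : K →+* MvPolynomial σ K)]
      exact IsUnit.map C (isUnit_iff_ne_zero.2 (Nat.cast_ne_zero.2 hd0.ne'))
    rw [nsmul_eq_mul] at h2
    exact (Ideal.unit_mul_mem_iff_mem _ h3).1 h2

theorem symbPow_add_le {K σ ι : Type*} [Field K] [CharZero K] [Fintype σ] [Nonempty ι]
    (P : ι → σ → K) (m s : ℕ) : symbPow P (m + s) ≤ irrel K σ ^ s * symbPow P m := by
  induction s with
  | zero => simp
  | succ s ih =>
    refine (symbPow_succ_le P (m + s)).trans ?_
    rw [pow_succ', mul_assoc]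
    exact Ideal.mul_mono_right ih

theorem aeval_C_mul_of_isHomogeneous {σ A : Type*} [CommRing A] [Fintype σ]
    {F : MvPolynomial σ A} {d : ℕ} (hF : F.IsHomogeneous d) (p : σ → A) (Y : MvPolynomial σ A) :
    aeval (fun l => C (p l) * Y) F = C (eval p F) * Y ^ d := by
  rw [aeval_def, eval₂_eq', eval_eq', map_sum, Finset.sum_mul]
  refine Finset.sum_congr rfl fun μ hμ => ?_
  have h1 : ∑ i, μ i = d := by
    rw [← Finsupp.degree_eq_sum, ← hF (mem_support_iff.1 hμ), Finsupp.degree_eq_weight_one]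
    rfl
  simp only [mul_pow, Finset.prod_mul_distrib, Finset.prod_pow_eq_pow_sum, h1, map_mul, map_prod,
    map_pow, mul_assoc, algebraMap_eq]

theorem homVanishingIdeal_eq_pointIdeal {K : Type*} [Field K] {N : ℕ} {p : Fin (N + 1) → K}
    {j : Fin (N + 1)} (hj : p j ≠ 0) :
    homVanishingIdeal p = pointIdeal (fun l => p l / p j) j := by
  refine le_antisymm (Ideal.span_le.2 ?_) (Ideal.span_le.2 ?_)
  · rintro F ⟨⟨d, hd⟩, hF⟩
    set I := pointIdeal (fun l => p l / p j) j with hI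
    have hX : ∀ l, Ideal.Quotient.mk I (X l) =
        Ideal.Quotient.mk I (C (p l) * (C (p j)⁻¹ * X j)) := fun l => by
      rw [← mul_assoc, ← C_mul, ← div_eq_mul_inv]
      rcases Fin.eq_self_or_eq_succAbove j l with rfl | ⟨l, rfl⟩
      · rw [div_self hj, C_1, one_mul]
      · exact Ideal.Quotient.eq.2 (Ideal.subset_span ⟨l, rfl⟩)
    have h1 : ∀ g : MvPolynomial (Fin (N + 1)) K, Ideal.Quotient.mk I g =
        Ideal.Quotient.mk I (aeval (fun l => C (p l) * (C (p j)⁻¹ * X j)) g) := fun g => by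
      induction g using MvPolynomial.induction_on with
      | C a => simp
      | add f g hf hg => rw [map_add, map_add, map_add, hf, hg]
      | mul_X f l hf => rw [map_mul, map_mul, map_mul, aeval_X, hf, hX]
    rw [SetLike.mem_coe, ← Ideal.Quotient.eq_zero_iff_mem, h1,
      aeval_C_mul_of_isHomogeneous hd, hF, C_0, zero_mul, map_zero]
  · rintro _ ⟨l, rfl⟩
    refine Ideal.subset_span ⟨⟨1, (isHomogeneous_X _ _).sub ?_⟩, ?_⟩
    · simpa using (isHomogeneous_C (Fin (N + 1)) (p (j.succAbove l) / p j)).mul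
        (isHomogeneous_X K j)
    · simp [hj]

/-- Char 0.  For the radical ideal `I` of a finite set of distinct points
of `P^N`, `I^{(t(N+m-1)+s)} ⊆ M^s (I^{(m)})^t` for all `s, t, m ≥ 1`. -/
theorem stmt19 {K : Type*} [Field K] [IsAlgClosed K] [CharZero K]
    {N n : ℕ} (hN : 1 ≤ N) (hn : 1 ≤ n)
    (P : Fin n → (Fin (N + 1) → K)) (hP : ProjectivelyDistinct P)
    (s t m : ℕ) (hs : 1 ≤ s) (ht : 1 ≤ t) (hm : 1 ≤ m) :
    symbPow P (t * (N + m - 1) + s) ≤ irrel K (Fin (N + 1)) ^ s * symbPow P m ^ t := by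
  have : Nonempty (Fin n) := ⟨⟨0, hn⟩⟩
  refine (symbPow_add_le P _ s).trans (Ideal.mul_mono_right ?_)
  choose j hj using fun i => Function.ne_iff.1 (hP.1 i)
  have h1 : ∀ m, symbPow P m = pointSymbPow (fun i l => P i l / P i (j i)) j m := fun m =>
    iInf_congr fun i => by rw [homVanishingIdeal_eq_pointIdeal (hj i)]
  rw [h1, h1]
  exact le_of_isHomogeneous_imp_mem (isHomogeneous_pointSymbPow _ j _) fun f hf d hd =>
    mem_pointSymbPow_pow_of_isHomogeneous hN _ j ht hm hd hf
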